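/- arXiv:0909.1733 — 5 statements merged into one kernel-verified Lean document; each statement's English description precedes it below -/
import Mathlib

section
/- There is a surjective group homomorphism π : Γ → (ℤ/2ℤ)² with π(γ₁) = (1,0), π(γ₂) = (0,1) and π(t_λ) = 0 for all λ ∈ Λ', whose kernel is exactly T; in other words there is a short exact sequence 1 → ℤ⁴ ≅ T → Γ → (ℤ/2ℤ)² → 1. -/
noncomputable def gamma1 (e₁ : ℂ) : Equiv.Perm (ℂ × ℂ) :=
  (Equiv.addRight (e₁ / 2)).prodCongr (Equiv.neg ℂ)

noncomputable def gamma2 (e₂ : ℂ) : Equiv.Perm (ℂ × ℂ) :=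
  (Equiv.neg ℂ).prodCongr (Equiv.addRight (e₂ / 2))

noncomputable def tr (v : ℂ × ℂ) : Equiv.Perm (ℂ × ℂ) := Equiv.addRight v

noncomputable def Gam (e₁ e₁' e₂ e₂' : ℂ) : Subgroup (Equiv.Perm (ℂ × ℂ)) :=
  Subgroup.closure {gamma1 e₁, gamma2 e₂, tr (e₁, 0), tr (e₁', 0), tr (0, e₂), tr (0, e₂')}

noncomputable def Lam (e₁ e₁' e₂ e₂' : ℂ) : AddSubgroup (ℂ × ℂ) :=
  AddSubgroup.closure {(e₁, 0), (e₁', 0), (0, e₂), (0, e₂')}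

lemma tr_apply (v z : ℂ × ℂ) : tr v z = z + v := rfl

lemma tr_zero : tr (0 : ℂ × ℂ) = 1 := Equiv.ext fun z => by
  simp [tr_apply]

lemma tr_mul (v w : ℂ × ℂ) : tr v * tr w = tr (v + w) := Equiv.ext fun z => by
  simp only [Equiv.Perm.mul_apply, tr_apply]
  abel

lemma tr_inv (v : ℂ × ℂ) : (tr v)⁻¹ = tr (-v) :=
  inv_eq_of_mul_eq_one_right (by rw [tr_mul, add_neg_cancel, tr_zero])

noncomputable def TT (e₁ e₁' e₂ e₂' : ℂ) : Subgroup (Equiv.Perm (ℂ × ℂ)) where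
  carrier := {g | ∃ v ∈ Lam e₁ e₁' e₂ e₂', g = tr v}
  one_mem' := ⟨0, zero_mem _, tr_zero.symm⟩
  mul_mem' := by
    rintro a b ⟨v, hv, rfl⟩ ⟨w, hw, rfl⟩
    exact ⟨v + w, add_mem hv hw, tr_mul v w⟩
  inv_mem' := by
    rintro a ⟨v, hv, rfl⟩
    exact ⟨-v, neg_mem hv, tr_inv v⟩

/-- `g` is the affine map `(z₁, z₂) ↦ ((-1)^q z₁ + p e₁/2 + m e₁', (-1)^p z₂ + q e₂/2 + n e₂')`. -/
def HasNormalForm (e₁ e₁' e₂ e₂' : ℂ) (g : Equiv.Perm (ℂ × ℂ)) (p q m n : ℤ) : Prop :=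
  ∀ z : ℂ × ℂ, g z =
    (((q.negOnePow : ℤ) : ℂ) * z.1 + p * (e₁ / 2) + m * e₁',
     ((p.negOnePow : ℤ) : ℂ) * z.2 + q * (e₂ / 2) + n * e₂')

lemma negOnePow_add_unit_mul (p p' : ℤ) (u : ℤˣ) :
    (p + u * p').negOnePow = p.negOnePow * p'.negOnePow := by
  rcases Int.units_eq_one_or u with rfl | rfl <;> simp [Int.negOnePow_add, Int.negOnePow_neg]

lemma intCast_eq_of_negOnePow_eq {p p' : ℤ} (h : p.negOnePow = p'.negOnePow) :
    (p : ZMod 2) = (p' : ZMod 2) := by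
  rw [Int.negOnePow_eq_iff, even_iff_two_dvd] at h
  rw [← sub_eq_zero, ← Int.cast_sub]
  exact (ZMod.intCast_zmod_eq_zero_iff_dvd _ 2).2 (by exact_mod_cast h)

lemma intCast_unit_mul_zmod_two (u : ℤˣ) (p : ℤ) : ((u * p : ℤ) : ZMod 2) = p := by
  rcases Int.units_eq_one_or u with rfl | rfl <;> simp

namespace HasNormalForm

variable {e₁ e₁' e₂ e₂' : ℂ} {g g' : Equiv.Perm (ℂ × ℂ)} {p q m n p' q' m' n' : ℤ}

lemma mul (h : HasNormalForm e₁ e₁' e₂ e₂' g p q m n)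
    (h' : HasNormalForm e₁ e₁' e₂ e₂' g' p' q' m' n') :
    HasNormalForm e₁ e₁' e₂ e₂' (g * g') (p + q.negOnePow * p') (q + p.negOnePow * q')
      (m + q.negOnePow * m') (n + p.negOnePow * n') := by
  intro z
  rw [Equiv.Perm.mul_apply, h' z, h, negOnePow_add_unit_mul, negOnePow_add_unit_mul]
  ext
  · push_cast
    ring
  · push_cast
    ring

lemma inv (h : HasNormalForm e₁ e₁' e₂ e₂' g p q m n) :
    HasNormalForm e₁ e₁' e₂ e₂' g⁻¹ (0 + ((-q.negOnePow : ℤˣ) : ℤ) * p)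
      (0 + ((-p.negOnePow : ℤˣ) : ℤ) * q)
      (-q.negOnePow * m) (-p.negOnePow * n) := by
  intro z
  rw [Equiv.Perm.inv_eq_iff_eq, h, negOnePow_add_unit_mul, negOnePow_add_unit_mul]
  rcases Int.units_eq_one_or q.negOnePow with hq | hq <;>
  rcases Int.units_eq_one_or p.negOnePow with hp | hp <;>
  · rw [hp, hq]
    ext <;> simp <;> ring

lemma intCast_unique (h : HasNormalForm e₁ e₁' e₂ e₂' g p q m n)
    (h' : HasNormalForm e₁ e₁' e₂ e₂' g p' q' m' n') :
    (p : ZMod 2) = p' ∧ (q : ZMod 2) = q' := by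
  have h0 := (h (0, 0)).symm.trans (h' (0, 0))
  have h1 := (h (1, 1)).symm.trans (h' (1, 1))
  simp only [Prod.mk.injEq, mul_zero, mul_one, zero_add] at h0 h1
  refine ⟨intCast_eq_of_negOnePow_eq (Units.ext ?_), intCast_eq_of_negOnePow_eq (Units.ext ?_)⟩
  · exact Int.cast_injective (α := ℂ) (by linear_combination h1.2 - h0.2)
  · exact Int.cast_injective (α := ℂ) (by linear_combination h1.1 - h0.1)

end HasNormalForm

section

variable (e₁ e₁' e₂ e₂' : ℂ)

lemma hasNormalForm_gamma1 : HasNormalForm e₁ e₁' e₂ e₂' (gamma1 e₁) 1 0 0 0 := by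
  intro z
  simp [gamma1, Prod.map]

lemma hasNormalForm_gamma2 : HasNormalForm e₁ e₁' e₂ e₂' (gamma2 e₂) 0 1 0 0 := by
  intro z
  simp [gamma2, Prod.map]

lemma hasNormalForm_tr (a b c d : ℤ) :
    HasNormalForm e₁ e₁' e₂ e₂' (tr (a * e₁ + b * e₁', c * e₂ + d * e₂'))
      (2 * a) (2 * c) b d := by
  intro z
  rw [tr_apply, Int.negOnePow_two_mul, Int.negOnePow_two_mul]
  ext
  · simp
    ring
  · simp
    ring

lemma exists_hasNormalForm {g : Equiv.Perm (ℂ × ℂ)} (hg : g ∈ Gam e₁ e₁' e₂ e₂') :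
    ∃ p q m n : ℤ, HasNormalForm e₁ e₁' e₂ e₂' g p q m n := by
  induction hg using Subgroup.closure_induction with
  | mem x hx =>
    simp only [Set.mem_insert_iff, Set.mem_singleton_iff] at hx
    rcases hx with rfl | rfl | rfl | rfl | rfl | rfl
    · exact ⟨_, _, _, _, hasNormalForm_gamma1 e₁ e₁' e₂ e₂'⟩
    · exact ⟨_, _, _, _, hasNormalForm_gamma2 e₁ e₁' e₂ e₂'⟩
    · exact ⟨_, _, _, _, by simpa using hasNormalForm_tr e₁ e₁' e₂ e₂' 1 0 0 0⟩
    · exact ⟨_, _, _, _, by simpa using hasNormalForm_tr e₁ e₁' e₂ e₂' 0 1 0 0⟩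
    · exact ⟨_, _, _, _, by simpa using hasNormalForm_tr e₁ e₁' e₂ e₂' 0 0 1 0⟩
    · exact ⟨_, _, _, _, by simpa using hasNormalForm_tr e₁ e₁' e₂ e₂' 0 0 0 1⟩
  | one => exact ⟨0, 0, 0, 0, fun z => by simp⟩
  | mul x y _ _ hx hy =>
    obtain ⟨p, q, m, n, h⟩ := hx
    obtain ⟨p', q', m', n', h'⟩ := hy
    exact ⟨_, _, _, _, h.mul h'⟩
  | inv x _ hx =>
    obtain ⟨p, q, m, n, h⟩ := hx
    exact ⟨_, _, _, _, h.inv⟩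

lemma exists_parityHom : ∃ π : ↥(Gam e₁ e₁' e₂ e₂') →* Multiplicative (ZMod 2 × ZMod 2),
    ∀ (g : ↥(Gam e₁ e₁' e₂ e₂')) (p q m n : ℤ),
      HasNormalForm e₁ e₁' e₂ e₂' g p q m n →
        π g = Multiplicative.ofAdd ((p : ZMod 2), (q : ZMod 2)) := by
  choose p q m n h using fun g : ↥(Gam e₁ e₁' e₂ e₂') => exists_hasNormalForm e₁ e₁' e₂ e₂' g.2
  refine ⟨MonoidHom.mk' (fun g => Multiplicative.ofAdd ((p g : ZMod 2), (q g : ZMod 2))) ?_, ?_⟩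
  · intro a b
    obtain ⟨hp, hq⟩ := (h (a * b)).intCast_unique ((h a).mul (h b))
    rw [Int.cast_add, intCast_unit_mul_zmod_two] at hp hq
    rw [hp, hq]
    rfl
  · intro g p' q' m' n' h'
    obtain ⟨hp, hq⟩ := (h g).intCast_unique h'
    rw [← hp, ← hq]
    rfl

/-- The homomorphism `ℤ⁴ → ℂ²` whose range is the lattice `Lam`. -/
noncomputable def latticeHom : (Fin 4 → ℤ) →+ ℂ × ℂ where
  toFun c := (c 0 * e₁ + c 1 * e₁', c 2 * e₂ + c 3 * e₂')
  map_zero' := by simp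
  map_add' c d := by
    ext
    · simp
      ring
    · simp
      ring

lemma latticeHom_apply (c : Fin 4 → ℤ) :
    latticeHom e₁ e₁' e₂ e₂' c = (c 0 * e₁ + c 1 * e₁', c 2 * e₂ + c 3 * e₂') := rfl

lemma range_latticeHom : (latticeHom e₁ e₁' e₂ e₂').range = Lam e₁ e₁' e₂ e₂' := by
  apply le_antisymm
  · rintro _ ⟨c, rfl⟩
    have h : latticeHom e₁ e₁' e₂ e₂' c =
        c 0 • (e₁, (0 : ℂ)) + c 1 • (e₁', (0 : ℂ)) + c 2 • ((0 : ℂ), e₂) + c 3 • ((0 : ℂ), e₂') := by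
      simp [latticeHom_apply]
    rw [h]
    unfold Lam
    refine add_mem (add_mem (add_mem ?_ ?_) ?_) ?_ <;>
      exact zsmul_mem (AddSubgroup.subset_closure (by simp)) _
  · refine (AddSubgroup.closure_le _).2 ?_
    rintro v hv
    simp only [Set.mem_insert_iff, Set.mem_singleton_iff] at hv
    rcases hv with rfl | rfl | rfl | rfl
    · exact ⟨![1, 0, 0, 0], by simp [latticeHom_apply]⟩
    · exact ⟨![0, 1, 0, 0], by simp [latticeHom_apply]⟩
    · exact ⟨![0, 0, 1, 0], by simp [latticeHom_apply]⟩
    · exact ⟨![0, 0, 0, 1], by simp [latticeHom_apply]⟩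

lemma mem_Lam_iff {v : ℂ × ℂ} : v ∈ Lam e₁ e₁' e₂ e₂' ↔
    ∃ a b c d : ℤ, v = (a * e₁ + b * e₁', c * e₂ + d * e₂') := by
  rw [← range_latticeHom]
  constructor
  · rintro ⟨c, rfl⟩
    exact ⟨c 0, c 1, c 2, c 3, rfl⟩
  · rintro ⟨a, b, c, d, rfl⟩
    exact ⟨![a, b, c, d], rfl⟩

variable {e₁ e₁' e₂ e₂'} in
lemma latticeHom_injective (h₁ : LinearIndependent ℝ ![e₁, e₁'])
    (h₂ : LinearIndependent ℝ ![e₂, e₂']) :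
    Function.Injective (latticeHom e₁ e₁' e₂ e₂') := by
  rw [injective_iff_map_eq_zero]
  intro c hc
  rw [latticeHom_apply, Prod.mk_eq_zero] at hc
  obtain ⟨h0, h1⟩ := LinearIndependent.pair_iff.1 h₁ (c 0) (c 1) (by simpa using hc.1)
  obtain ⟨h2, h3⟩ := LinearIndependent.pair_iff.1 h₂ (c 2) (c 3) (by simpa using hc.2)
  ext i
  fin_cases i
  · exact_mod_cast h0
  · exact_mod_cast h1
  · exact_mod_cast h2
  · exact_mod_cast h3

lemma tr_injective : Function.Injective tr := fun v w h => by
  simpa [tr_apply] using congrArg (fun g : Equiv.Perm (ℂ × ℂ) => g 0) h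

variable {e₁ e₁' e₂ e₂'} in
lemma nonempty_TT_mulEquiv (h₁ : LinearIndependent ℝ ![e₁, e₁'])
    (h₂ : LinearIndependent ℝ ![e₂, e₂']) :
    Nonempty (↥(TT e₁ e₁' e₂ e₂') ≃* Multiplicative (Fin 4 → ℤ)) := by
  let f : Multiplicative (Fin 4 → ℤ) →* Equiv.Perm (ℂ × ℂ) :=
    MonoidHom.mk' (fun c => tr (latticeHom e₁ e₁' e₂ e₂' c.toAdd)) fun c d => by
      rw [tr_mul, toAdd_mul, map_add]
  have hf : Function.Injective f := fun c d h =>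
    Multiplicative.toAdd.injective (latticeHom_injective h₁ h₂ (tr_injective h))
  have hr : f.range = TT e₁ e₁' e₂ e₂' := by
    ext g
    constructor
    · rintro ⟨c, rfl⟩
      exact ⟨_, range_latticeHom e₁ e₁' e₂ e₂' ▸ ⟨c.toAdd, rfl⟩, rfl⟩
    · rintro ⟨v, hv, rfl⟩
      rw [← range_latticeHom] at hv
      obtain ⟨c, rfl⟩ := hv
      exact ⟨Multiplicative.ofAdd c, rfl⟩
  exact ⟨((MonoidHom.ofInjective hf).trans (MulEquiv.subgroupCongr hr)).symm⟩

end

/-- There is a surjective homomorphism π : Γ → (ℤ/2ℤ)² with π(γ₁) = (1,0), π(γ₂) = (0,1),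
π(t_λ) = 0 for λ ∈ Λ', and kernel exactly T; i.e. a short exact sequence
1 → ℤ⁴ ≅ T → Γ → (ℤ/2ℤ)² → 1. -/
theorem stmt_2 (e₁ e₁' e₂ e₂' : ℂ)
    (h₁ : LinearIndependent ℝ ![e₁, e₁'])
    (h₂ : LinearIndependent ℝ ![e₂, e₂']) :
    ∃ π : ↥(Gam e₁ e₁' e₂ e₂') →* Multiplicative (ZMod 2 × ZMod 2),
      Function.Surjective π ∧
      (∀ g : ↥(Gam e₁ e₁' e₂ e₂'), (g : Equiv.Perm (ℂ × ℂ)) = gamma1 e₁ →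
        π g = Multiplicative.ofAdd (1, 0)) ∧
      (∀ g : ↥(Gam e₁ e₁' e₂ e₂'), (g : Equiv.Perm (ℂ × ℂ)) = gamma2 e₂ →
        π g = Multiplicative.ofAdd (0, 1)) ∧
      (∀ g : ↥(Gam e₁ e₁' e₂ e₂'), ∀ v ∈ Lam e₁ e₁' e₂ e₂',
        (g : Equiv.Perm (ℂ × ℂ)) = tr v → π g = 1) ∧
      π.ker = (TT e₁ e₁' e₂ e₂').subgroupOf (Gam e₁ e₁' e₂ e₂') ∧
      Nonempty (↥(TT e₁ e₁' e₂ e₂') ≃* Multiplicative (Fin 4 → ℤ)) := by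
  obtain ⟨π, hπ⟩ := exists_parityHom e₁ e₁' e₂ e₂'
  have hπ₁ : ∀ g : ↥(Gam e₁ e₁' e₂ e₂'), (g : Equiv.Perm (ℂ × ℂ)) = gamma1 e₁ →
      π g = Multiplicative.ofAdd (1, 0) := fun g hg => by
    simpa using hπ g 1 0 0 0 (hg ▸ hasNormalForm_gamma1 e₁ e₁' e₂ e₂')
  have hπ₂ : ∀ g : ↥(Gam e₁ e₁' e₂ e₂'), (g : Equiv.Perm (ℂ × ℂ)) = gamma2 e₂ →
      π g = Multiplicative.ofAdd (0, 1) := fun g hg => by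
    simpa using hπ g 0 1 0 0 (hg ▸ hasNormalForm_gamma2 e₁ e₁' e₂ e₂')
  have hπt : ∀ g : ↥(Gam e₁ e₁' e₂ e₂'), ∀ v ∈ Lam e₁ e₁' e₂ e₂',
      (g : Equiv.Perm (ℂ × ℂ)) = tr v → π g = 1 := fun g v hv hg => by
    obtain ⟨a, b, c, d, rfl⟩ := (mem_Lam_iff e₁ e₁' e₂ e₂').1 hv
    rw [hπ g _ _ _ _ (hg ▸ hasNormalForm_tr e₁ e₁' e₂ e₂' a b c d), Int.cast_mul, Int.cast_mul,
      show ((2 : ℤ) : ZMod 2) = 0 from rfl, zero_mul, zero_mul]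
    rfl
  refine ⟨π, ?_, hπ₁, hπ₂, hπt, ?_, nonempty_TT_mulEquiv h₁ h₂⟩
  · let g₁ : ↥(Gam e₁ e₁' e₂ e₂') := ⟨gamma1 e₁, Subgroup.subset_closure (by simp)⟩
    let g₂ : ↥(Gam e₁ e₁' e₂ e₂') := ⟨gamma2 e₂, Subgroup.subset_closure (by simp)⟩
    have key : ∀ x : ZMod 2 × ZMod 2, x = x.1.val • (1, 0) + x.2.val • (0, 1) := by decide
    intro x
    refine ⟨g₁ ^ x.toAdd.1.val * g₂ ^ x.toAdd.2.val, ?_⟩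
    rw [map_mul, map_pow, map_pow, hπ₁ g₁ rfl, hπ₂ g₂ rfl]
    exact congrArg Multiplicative.ofAdd (key x.toAdd).symm
  · ext g
    rw [MonoidHom.mem_ker, Subgroup.mem_subgroupOf]
    constructor
    · intro hg
      obtain ⟨p, q, m, n, h⟩ := exists_hasNormalForm e₁ e₁' e₂ e₂' g.2
      rw [hπ g p q m n h, ofAdd_eq_one, Prod.mk_eq_zero] at hg
      obtain ⟨a, rfl⟩ := (ZMod.intCast_zmod_eq_zero_iff_dvd p 2).1 hg.1
      obtain ⟨c, rfl⟩ := (ZMod.intCast_zmod_eq_zero_iff_dvd q 2).1 hg.2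
      exact ⟨_, (mem_Lam_iff e₁ e₁' e₂ e₂').2 ⟨a, m, c, n, rfl⟩, Equiv.ext fun z =>
        (h z).trans (hasNormalForm_tr e₁ e₁' e₂ e₂' a m c n z).symm⟩
    · rintro ⟨v, hv, hg⟩
      exact hπt g v hv hg
end

section
/- If γ ∈ Γ lies in the coset γ₁T or in the coset γ₂T (i.e. γ maps to (1,0) or (0,1) under the surjection Γ → (ℤ/2ℤ)² with kernel T), then the induced map of γ on the torus A := ℂ²⧸Λ' has no fixed points; in particular γ₁ and γ₂ act freely on A. -/
lemma fst_mem_closure_pair {e₁ e₁' e₂ e₂' : ℂ} {v : ℂ × ℂ} (hv : v ∈ Lam e₁ e₁' e₂ e₂') :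
    v.1 ∈ AddSubgroup.closure {e₁, e₁'} := by
  suffices h : Lam e₁ e₁' e₂ e₂' ≤
      (AddSubgroup.closure {e₁, e₁'}).comap (AddMonoidHom.fst ℂ ℂ) from h hv
  refine (AddSubgroup.closure_le _).2 ?_
  rintro _ (rfl | rfl | rfl | rfl)
  · exact AddSubgroup.subset_closure (by simp)
  · exact AddSubgroup.subset_closure (by simp)
  · exact zero_mem (AddSubgroup.closure {e₁, e₁'})
  · exact zero_mem (AddSubgroup.closure {e₁, e₁'})

lemma snd_mem_closure_pair {e₁ e₁' e₂ e₂' : ℂ} {v : ℂ × ℂ} (hv : v ∈ Lam e₁ e₁' e₂ e₂') :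
    v.2 ∈ AddSubgroup.closure {e₂, e₂'} := by
  suffices h : Lam e₁ e₁' e₂ e₂' ≤
      (AddSubgroup.closure {e₂, e₂'}).comap (AddMonoidHom.snd ℂ ℂ) from h hv
  refine (AddSubgroup.closure_le _).2 ?_
  rintro _ (rfl | rfl | rfl | rfl)
  · exact zero_mem (AddSubgroup.closure {e₂, e₂'})
  · exact zero_mem (AddSubgroup.closure {e₂, e₂'})
  · exact AddSubgroup.subset_closure (by simp)
  · exact AddSubgroup.subset_closure (by simp)

lemma half_notMem_closure_pair {e e' : ℂ} (h : LinearIndependent ℝ ![e, e']) :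
    e / 2 ∉ AddSubgroup.closure {e, e'} := by
  intro hmem
  obtain ⟨m, n, hmn⟩ := AddSubgroup.mem_closure_pair.1 hmem
  have hm : (m : ℝ) - 1 / 2 = 0 := by
    refine (LinearIndependent.pair_iff.1 h ((m : ℝ) - 1 / 2) (n : ℝ) ?_).1
    simp only [zsmul_eq_mul] at hmn
    simp only [Complex.real_smul]
    push_cast
    linear_combination hmn
  have hm' : 2 * m = 1 := by
    have : (2 * m : ℝ) = 1 := by linarith
    exact_mod_cast this
  omega

/-- If γ ∈ Γ lies in the coset γ₁T or γ₂T, then the induced map of γ on the torus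
A = ℂ²⧸Λ' has no fixed points; in particular γ₁ and γ₂ act freely on A. -/
theorem stmt_5 (e₁ e₁' e₂ e₂' : ℂ)
    (h₁ : LinearIndependent ℝ ![e₁, e₁'])
    (h₂ : LinearIndependent ℝ ![e₂, e₂'])
    (g : Equiv.Perm (ℂ × ℂ))
    (hg : (∃ t ∈ TT e₁ e₁' e₂ e₂', g = gamma1 e₁ * t) ∨
          (∃ t ∈ TT e₁ e₁' e₂ e₂', g = gamma2 e₂ * t)) :
    ∀ z : ℂ × ℂ,
      (QuotientAddGroup.mk (g z) : (ℂ × ℂ) ⧸ Lam e₁ e₁' e₂ e₂') ≠ QuotientAddGroup.mk z := by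
  intro z hz
  have hmem := QuotientAddGroup.eq.1 hz.symm
  rcases hg with ⟨_, ⟨v, hv, rfl⟩, rfl⟩ | ⟨_, ⟨v, hv, rfl⟩, rfl⟩
  · refine half_notMem_closure_pair h₁ ?_
    convert sub_mem (fst_mem_closure_pair hmem) (fst_mem_closure_pair hv) using 1
    simp [gamma1, tr_apply]
    ring
  · refine half_notMem_closure_pair h₂ ?_
    convert sub_mem (snd_mem_closure_pair hmem) (snd_mem_closure_pair hv) using 1
    simp [gamma2, tr_apply]
    ring
end

section
/- In Γ one has γ₂ γ₁ = t_{(0,e₂)} t_{(e₁,0)}⁻¹ γ₁ γ₂; consequently the element t_{(0,e₂)} t_{(e₁,0)}⁻¹ (translation by (−e₁, e₂)) lies in the commutator subgroup [Γ, Γ]. -/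
lemma gamma2_mul_gamma1 (e₁ e₂ : ℂ) :
    gamma2 e₂ * gamma1 e₁ = tr (0, e₂) * (tr (e₁, 0))⁻¹ * gamma1 e₁ * gamma2 e₂ := by
  rw [tr_inv]
  ext ⟨z₁, z₂⟩ <;>
    simp only [Equiv.Perm.mul_apply, tr_apply, gamma1, gamma2, Equiv.prodCongr_apply, Prod.map,
      Equiv.neg_apply, Equiv.coe_addRight, Prod.neg_mk, Prod.mk_add_mk] <;>
    ring

lemma tr_mul_tr_inv_eq_mul_inv (e₁ e₂ : ℂ) :
    tr (0, e₂) * (tr (e₁, 0))⁻¹ =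
      gamma2 e₂ * gamma1 e₁ * (gamma2 e₂)⁻¹ * (gamma1 e₁)⁻¹ := by
  rw [gamma2_mul_gamma1]
  group

/-- In Γ one has γ₂ γ₁ = t_{(0,e₂)} t_{(e₁,0)}⁻¹ γ₁ γ₂; consequently the element
t_{(0,e₂)} t_{(e₁,0)}⁻¹ (translation by (−e₁, e₂)) lies in the commutator subgroup [Γ,Γ]. -/
theorem stmt_8 (e₁ e₁' e₂ e₂' : ℂ)
    (h₁ : LinearIndependent ℝ ![e₁, e₁'])
    (h₂ : LinearIndependent ℝ ![e₂, e₂']) :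
    gamma2 e₂ * gamma1 e₁ = tr (0, e₂) * (tr (e₁, 0))⁻¹ * gamma1 e₁ * gamma2 e₂ ∧
    tr (0, e₂) * (tr (e₁, 0))⁻¹ ∈ ⁅Gam e₁ e₁' e₂ e₂', Gam e₁ e₁' e₂ e₂'⁆ := by
  refine ⟨gamma2_mul_gamma1 e₁ e₂, ?_⟩
  have hγ₁ : gamma1 e₁ ∈ Gam e₁ e₁' e₂ e₂' := Subgroup.subset_closure (by simp)
  have hγ₂ : gamma2 e₂ ∈ Gam e₁ e₁' e₂ e₂' := Subgroup.subset_closure (by simp)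
  rw [tr_mul_tr_inv_eq_mul_inv]
  exact Subgroup.commutator_mem_commutator hγ₂ hγ₁
end

section
/- The abelianization Γ₁/[Γ₁,Γ₁] of the subgroup Γ₁ := ⟨γ₁, t_{(e₁',0)}, t_{(0,e₂)}, t_{(0,e₂')}⟩ is isomorphic to ℤ² × (ℤ/2ℤ)², with the free part generated by the classes of γ₁ and t_{(e₁',0)}. -/
/-- Γ₁ = ⟨γ₁, t_{(e₁',0)}, t_{(0,e₂)}, t_{(0,e₂')}⟩ ≤ Γ. -/
noncomputable def Gam1 (e₁ e₁' e₂ e₂' : ℂ) : Subgroup (Equiv.Perm (ℂ × ℂ)) :=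
  Subgroup.closure {gamma1 e₁, tr (e₁', 0), tr (0, e₂), tr (0, e₂')}

lemma tr_zpow (v : ℂ × ℂ) (n : ℤ) : tr v ^ n = tr (n • v) := by
  induction n using Int.induction_on with
  | zero => simp [tr_zero]
  | succ k ih => rw [zpow_add_one, ih, tr_mul, add_smul, one_smul]
  | pred k ih => rw [zpow_sub_one, ih, tr_inv, tr_mul, sub_smul, one_smul, sub_eq_add_neg]

lemma gamma1_apply (e₁ : ℂ) (z : ℂ × ℂ) : gamma1 e₁ z = (z.1 + e₁ / 2, -z.2) := rfl

lemma gamma1_inv_apply (e₁ : ℂ) (z : ℂ × ℂ) :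
    (gamma1 e₁)⁻¹ z = (z.1 - e₁ / 2, -z.2) := by
  rw [Equiv.Perm.inv_eq_iff_eq, gamma1_apply]
  simp

lemma gamma1_zpow_apply (e₁ : ℂ) (n : ℤ) (z : ℂ × ℂ) :
    (gamma1 e₁ ^ n) z = (z.1 + n * (e₁ / 2), ((n.negOnePow : ℤ) : ℂ) * z.2) := by
  induction n using Int.induction_on generalizing z with
  | zero => simp
  | succ k ih =>
    rw [zpow_add_one, Equiv.Perm.mul_apply, gamma1_apply, ih, Int.negOnePow_succ]
    ext <;> push_cast <;> ring
  | pred k ih =>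
    rw [zpow_sub_one, Equiv.Perm.mul_apply, gamma1_inv_apply, ih, Int.negOnePow_sub,
      Int.negOnePow_one]
    ext <;> push_cast <;> ring

/-- The normal form `t_{(0,e₂)}^a t_{(0,e₂')}^b t_{(e₁',0)}^m γ₁^n` of an element of `Γ₁`. -/
noncomputable def normalForm (e₁ e₁' e₂ e₂' : ℂ) (n m a b : ℤ) : Equiv.Perm (ℂ × ℂ) :=
  tr (0, e₂) ^ a * tr (0, e₂') ^ b * tr (e₁', 0) ^ m * gamma1 e₁ ^ n

lemma normalForm_apply (e₁ e₁' e₂ e₂' : ℂ) (n m a b : ℤ) (z : ℂ × ℂ) :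
    normalForm e₁ e₁' e₂ e₂' n m a b z =
      (z.1 + n * (e₁ / 2) + m * e₁', ((n.negOnePow : ℤ) : ℂ) * z.2 + a * e₂ + b * e₂') := by
  simp only [normalForm, tr_zpow, Equiv.Perm.mul_apply, gamma1_zpow_apply, tr_apply]
  ext <;> simp
  ring

lemma normalForm_mul (e₁ e₁' e₂ e₂' : ℂ) (n m a b n' m' a' b' : ℤ) :
    normalForm e₁ e₁' e₂ e₂' n m a b * normalForm e₁ e₁' e₂ e₂' n' m' a' b' =
      normalForm e₁ e₁' e₂ e₂' (n + n') (m + m') (a + n.negOnePow * a')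
        (b + n.negOnePow * b') := by
  refine Equiv.ext fun z => ?_
  simp only [Equiv.Perm.mul_apply, normalForm_apply, Int.negOnePow_add]
  ext <;> push_cast <;> ring

lemma normalForm_zero (e₁ e₁' e₂ e₂' : ℂ) : normalForm e₁ e₁' e₂ e₂' 0 0 0 0 = 1 := by
  simp [normalForm]

lemma normalForm_inv (e₁ e₁' e₂ e₂' : ℂ) (n m a b : ℤ) :
    (normalForm e₁ e₁' e₂ e₂' n m a b)⁻¹ =
      normalForm e₁ e₁' e₂ e₂' (-n) (-m) (-(n.negOnePow * a)) (-(n.negOnePow * b)) := by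
  have h : ((n.negOnePow : ℤ)) * n.negOnePow = 1 := by
    rw [← Units.val_mul, Int.units_mul_self, Units.val_one]
  refine inv_eq_of_mul_eq_one_right ?_
  rw [normalForm_mul, mul_neg, mul_neg, ← mul_assoc, ← mul_assoc, h,
    ← normalForm_zero e₁ e₁' e₂ e₂']
  simp

lemma normalForm_mem (e₁ e₁' e₂ e₂' : ℂ) (n m a b : ℤ) :
    normalForm e₁ e₁' e₂ e₂' n m a b ∈ Gam1 e₁ e₁' e₂ e₂' :=
  mul_mem (mul_mem (mul_mem
    (zpow_mem (Subgroup.subset_closure (by simp)) a)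
    (zpow_mem (Subgroup.subset_closure (by simp)) b))
    (zpow_mem (Subgroup.subset_closure (by simp)) m))
    (zpow_mem (Subgroup.subset_closure (by simp)) n)

lemma exists_eq_normalForm {e₁ e₁' e₂ e₂' : ℂ} {g : Equiv.Perm (ℂ × ℂ)}
    (hg : g ∈ Gam1 e₁ e₁' e₂ e₂') :
    ∃ n m a b : ℤ, g = normalForm e₁ e₁' e₂ e₂' n m a b := by
  induction hg using Subgroup.closure_induction with
  | mem x hx =>
    rcases hx with rfl | rfl | rfl | rfl
    · exact ⟨1, 0, 0, 0, by simp [normalForm]⟩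
    · exact ⟨0, 1, 0, 0, by simp [normalForm]⟩
    · exact ⟨0, 0, 1, 0, by simp [normalForm]⟩
    · exact ⟨0, 0, 0, 1, by simp [normalForm]⟩
  | one => exact ⟨0, 0, 0, 0, (normalForm_zero ..).symm⟩
  | mul x y _ _ hx hy =>
    obtain ⟨n, m, a, b, rfl⟩ := hx
    obtain ⟨n', m', a', b', rfl⟩ := hy
    exact ⟨_, _, _, _, normalForm_mul ..⟩
  | inv x _ hx =>
    obtain ⟨n, m, a, b, rfl⟩ := hx
    exact ⟨_, _, _, _, normalForm_inv ..⟩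

lemma LinearIndependent.pair_intCast_eq {u v : ℂ} (h : LinearIndependent ℝ ![u, v])
    {n m n' m' : ℤ} (heq : (n : ℂ) * u + m * v = n' * u + m' * v) : n = n' ∧ m = m' := by
  have key := LinearIndependent.pair_iff.mp h ((n : ℝ) - n') ((m : ℝ) - m') (by
    simp only [Complex.real_smul]
    push_cast
    linear_combination heq)
  exact ⟨by exact_mod_cast sub_eq_zero.mp key.1, by exact_mod_cast sub_eq_zero.mp key.2⟩

lemma normalForm_injective {e₁ e₁' e₂ e₂' : ℂ}
    (h₁ : LinearIndependent ℝ ![e₁, e₁']) (h₂ : LinearIndependent ℝ ![e₂, e₂'])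
    {n m a b n' m' a' b' : ℤ}
    (h : normalForm e₁ e₁' e₂ e₂' n m a b = normalForm e₁ e₁' e₂ e₂' n' m' a' b') :
    n = n' ∧ m = m' ∧ a = a' ∧ b = b' := by
  have h0 := congrArg (fun f : Equiv.Perm (ℂ × ℂ) => f (0, 0)) h
  simp only [normalForm_apply, Prod.mk.injEq, zero_add, mul_zero] at h0
  obtain ⟨ha, hb⟩ := h₂.pair_intCast_eq h0.2
  obtain ⟨hn, hm⟩ := h₁.pair_intCast_eq (n := n) (m := 2 * m) (n' := n') (m' := 2 * m') (by
    push_cast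
    linear_combination 2 * h0.1)
  exact ⟨hn, by omega, ha, hb⟩

lemma exists_hom_normalForm {e₁ e₁' e₂ e₂' : ℂ}
    (h₁ : LinearIndependent ℝ ![e₁, e₁']) (h₂ : LinearIndependent ℝ ![e₂, e₂']) :
    ∃ ψ : Gam1 e₁ e₁' e₂ e₂' →* Multiplicative ((ℤ × ℤ) × (ZMod 2 × ZMod 2)),
      ∀ n m a b : ℤ, ψ ⟨_, normalForm_mem e₁ e₁' e₂ e₂' n m a b⟩ =
        Multiplicative.ofAdd ((n, m), ((a : ZMod 2), (b : ZMod 2))) := by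
  choose n m a b hg using fun g : Gam1 e₁ e₁' e₂ e₂' => exists_eq_normalForm g.2
  refine ⟨MonoidHom.mk' (fun g => Multiplicative.ofAdd
    ((n g, m g), ((a g : ZMod 2), (b g : ZMod 2)))) fun x y => ?_, fun n' m' a' b' => ?_⟩
  · have hxy : ((x * y : Gam1 e₁ e₁' e₂ e₂') : Equiv.Perm (ℂ × ℂ)) = x * y := rfl
    rw [hg (x * y), hg x, hg y, normalForm_mul] at hxy
    obtain ⟨hn, hm, ha, hb⟩ := normalForm_injective h₁ h₂ hxy
    rw [hn, hm, ha, hb, ← ofAdd_add]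
    simp
  · obtain ⟨hn, hm, ha, hb⟩ := normalForm_injective h₁ h₂
      (hg ⟨_, normalForm_mem e₁ e₁' e₂ e₂' n' m' a' b'⟩)
    simp only [MonoidHom.mk'_apply]
    rw [← hn, ← hm, ← ha, ← hb]

open scoped commutatorElement in
/-- Translations by twice a vector of the lattice `ℤ e₂ + ℤ e₂'` are commutators in `Γ₁`. -/
lemma normalForm_even_mem_commutator (e₁ e₁' e₂ e₂' : ℂ) (a b : ℤ) :
    (⟨_, normalForm_mem e₁ e₁' e₂ e₂' 0 0 (2 * a) (2 * b)⟩ : Gam1 e₁ e₁' e₂ e₂') ∈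
      commutator (Gam1 e₁ e₁' e₂ e₂') := by
  have h : (⟨_, normalForm_mem e₁ e₁' e₂ e₂' 0 0 (2 * a) (2 * b)⟩ : Gam1 e₁ e₁' e₂ e₂') =
      ⁅(⟨_, normalForm_mem e₁ e₁' e₂ e₂' 0 0 a b⟩ : Gam1 e₁ e₁' e₂ e₂'),
        ⟨_, normalForm_mem e₁ e₁' e₂ e₂' 1 0 0 0⟩⁆ := by
    refine Subtype.ext ?_
    rw [commutatorElement_def]
    simp only [Subgroup.coe_mul, Subgroup.coe_inv, normalForm_inv, normalForm_mul]
    congr 1 <;> simp <;> ring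
  rw [h]
  exact Subgroup.commutator_mem_commutator (Subgroup.mem_top _) (Subgroup.mem_top _)

/-- The abelianization Γ₁/[Γ₁,Γ₁] is isomorphic to ℤ² × (ℤ/2ℤ)², with the free part
generated by the classes of γ₁ and t_{(e₁',0)}. -/
theorem stmt_11 (e₁ e₁' e₂ e₂' : ℂ)
    (h₁ : LinearIndependent ℝ ![e₁, e₁'])
    (h₂ : LinearIndependent ℝ ![e₂, e₂']) :
    ∃ φ : Abelianization ↥(Gam1 e₁ e₁' e₂ e₂') ≃*
        Multiplicative ((ℤ × ℤ) × (ZMod 2 × ZMod 2)),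
      φ (Abelianization.of ⟨gamma1 e₁, Subgroup.subset_closure (by simp)⟩) =
        Multiplicative.ofAdd ((1, 0), (0, 0)) ∧
      φ (Abelianization.of ⟨tr (e₁', 0), Subgroup.subset_closure (by simp)⟩) =
        Multiplicative.ofAdd ((0, 1), (0, 0)) := by
  obtain ⟨ψ, hψ⟩ := exists_hom_normalForm h₁ h₂
  have hsurj : Function.Surjective ψ := by
    rintro ⟨⟨n, m⟩, a, b⟩
    obtain ⟨a, rfl⟩ := ZMod.intCast_surjective a
    obtain ⟨b, rfl⟩ := ZMod.intCast_surjective b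
    exact ⟨_, hψ n m a b⟩
  have hker : commutator (Gam1 e₁ e₁' e₂ e₂') = ψ.ker := by
    refine le_antisymm (Abelianization.commutator_subset_ker ψ) ?_
    rintro ⟨g, hg⟩ hgψ
    obtain ⟨n, m, a, b, rfl⟩ := exists_eq_normalForm hg
    rw [MonoidHom.mem_ker, hψ, ofAdd_eq_one] at hgψ
    simp only [Prod.mk_eq_zero, ZMod.intCast_zmod_eq_zero_iff_dvd] at hgψ
    obtain ⟨⟨rfl, rfl⟩, ⟨a, rfl⟩, b, rfl⟩ := hgψ
    exact normalForm_even_mem_commutator e₁ e₁' e₂ e₂' a b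
  refine ⟨(QuotientGroup.quotientMulEquivOfEq hker).trans
    (QuotientGroup.quotientKerEquivOfSurjective ψ hsurj), ?_, ?_⟩
  · refine Eq.trans (congrArg ψ (Subtype.ext ?_)) (hψ 1 0 0 0)
    simp [normalForm]
  · refine Eq.trans (congrArg ψ (Subtype.ext ?_)) (hψ 0 1 0 0)
    simp [normalForm]
end

section
/- The abelianization Γ/[Γ,Γ] of Γ is isomorphic to ℤ/4ℤ × (ℤ/2ℤ)³; an isomorphism can be chosen sending the class of γ₁ to (1,0,0,0), the class of γ₂ to (1,1,0,0), the class of t_{(e₁',0)} to (0,0,1,0) and the class of t_{(0,e₂')} to (0,0,0,1). -/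
/-- `g` is the affine map
`z ↦ ((-1)^q z₁ + (p/2) e₁ + m e₁', (-1)^p z₂ + (q/2) e₂ + n e₂')`. -/
def NormalForm (e₁ e₁' e₂ e₂' : ℂ) (p q m n : ℤ) (g : Equiv.Perm (ℂ × ℂ)) : Prop :=
  ∀ z : ℂ × ℂ, g z =
    (((q.negOnePow : ℤ) : ℂ) * z.1 + p / 2 * e₁ + m * e₁',
      ((p.negOnePow : ℤ) : ℂ) * z.2 + q / 2 * e₂ + n * e₂')

lemma negOnePow_cast_zmod_four (q : ℤ) : ((q.negOnePow : ℤ) : ZMod 4) = 1 + 2 * q := by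
  have h4 : (4 : ZMod 4) = 0 := by decide
  rcases Int.even_or_odd q with h | h
  · rw [Int.negOnePow_even q h]
    obtain ⟨r, rfl⟩ := h
    push_cast
    linear_combination -(r : ZMod 4) * h4
  · rw [Int.negOnePow_odd q h]
    obtain ⟨r, rfl⟩ := h
    push_cast
    linear_combination -(r + 1 : ZMod 4) * h4

lemma negOnePow_cast_zmod_two (q : ℤ) : ((q.negOnePow : ℤ) : ZMod 2) = 1 := by
  rcases Int.even_or_odd q with h | h
  · simp [Int.negOnePow_even q h]
  · rw [Int.negOnePow_odd q h]
    decide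

lemma negOnePow_negOnePow_mul (p q : ℤ) :
    ((q.negOnePow : ℤ) * p).negOnePow = p.negOnePow := by
  rcases Int.even_or_odd q with h | h
  · simp [Int.negOnePow_even q h]
  · simp [Int.negOnePow_odd q h]

lemma negOnePow_mul_self (q : ℤ) : ((q.negOnePow : ℤ) : ℂ) * ((q.negOnePow : ℤ) : ℂ) = 1 := by
  rcases Int.even_or_odd q with h | h
  · simp [Int.negOnePow_even q h]
  · simp [Int.negOnePow_odd q h]

/-- The value of the abelianization map on the normal form with parameters `p q m n`. -/
def abelianValue (p q m n : ℤ) : Multiplicative (ZMod 4 × ZMod 2 × ZMod 2 × ZMod 2) :=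
  Multiplicative.ofAdd ((p + q + 2 * p * q : ZMod 4), (q : ZMod 2), (m : ZMod 2), (n : ZMod 2))

lemma abelianValue_mul (p q m n p' q' m' n' : ℤ) :
    abelianValue (p + q.negOnePow * p') (q + p.negOnePow * q')
        (m + q.negOnePow * m') (n + p.negOnePow * n') =
      abelianValue p q m n * abelianValue p' q' m' n' := by
  unfold abelianValue
  rw [← ofAdd_add]
  congr 1
  ext
  · push_cast [negOnePow_cast_zmod_four]
    generalize (p : ZMod 4) = a
    generalize (q : ZMod 4) = b
    generalize (p' : ZMod 4) = c
    generalize (q' : ZMod 4) = d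
    change _ = (a + b + 2 * a * b) + (c + d + 2 * c * d)
    revert a b c d
    decide
  all_goals
    push_cast [negOnePow_cast_zmod_two]
    simp

namespace NormalForm

variable {e₁ e₁' e₂ e₂' : ℂ}

lemma mul {p q m n p' q' m' n' : ℤ} {g g' : Equiv.Perm (ℂ × ℂ)}
    (h : NormalForm e₁ e₁' e₂ e₂' p q m n g) (h' : NormalForm e₁ e₁' e₂ e₂' p' q' m' n' g') :
    NormalForm e₁ e₁' e₂ e₂' (p + q.negOnePow * p') (q + p.negOnePow * q')
      (m + q.negOnePow * m') (n + p.negOnePow * n') (g * g') := by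
  intro z
  rw [Equiv.Perm.mul_apply, h', h]
  simp only [Int.negOnePow_add, negOnePow_negOnePow_mul]
  push_cast
  ext <;> simp only [] <;> ring

lemma inv {p q m n : ℤ} {g : Equiv.Perm (ℂ × ℂ)} (h : NormalForm e₁ e₁' e₂ e₂' p q m n g) :
    NormalForm e₁ e₁' e₂ e₂' (q.negOnePow * -p) (p.negOnePow * -q)
      (q.negOnePow * -m) (p.negOnePow * -n) g⁻¹ := by
  intro z
  rw [Equiv.Perm.inv_eq_iff_eq, h]
  simp only [negOnePow_negOnePow_mul, Int.negOnePow_neg]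
  push_cast
  have hp := negOnePow_mul_self p
  have hq := negOnePow_mul_self q
  ext <;> simp only []
  · linear_combination -(z.1 - p / 2 * e₁ - m * e₁') * hq
  · linear_combination -(z.2 - q / 2 * e₂ - n * e₂') * hp

lemma gamma1 : NormalForm e₁ e₁' e₂ e₂' 1 0 0 0 (gamma1 e₁) := by
  intro z
  ext <;> simp [_root_.gamma1]
  ring

lemma gamma2 : NormalForm e₁ e₁' e₂ e₂' 0 1 0 0 (gamma2 e₂) := by
  intro z
  ext <;> simp [_root_.gamma2]
  ring

lemma tr_fst : NormalForm e₁ e₁' e₂ e₂' 2 0 0 0 (tr (e₁, 0)) := by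
  intro z
  ext <;> simp [tr_apply, Int.negOnePow_even 2 even_two]

lemma tr_fst' : NormalForm e₁ e₁' e₂ e₂' 0 0 1 0 (tr (e₁', 0)) := by
  intro z
  ext <;> simp [tr_apply]

lemma tr_snd : NormalForm e₁ e₁' e₂ e₂' 0 2 0 0 (tr (0, e₂)) := by
  intro z
  ext <;> simp [tr_apply, Int.negOnePow_even 2 even_two]

lemma tr_snd' : NormalForm e₁ e₁' e₂ e₂' 0 0 0 1 (tr (0, e₂')) := by
  intro z
  ext <;> simp [tr_apply]

lemma exists_of_mem {g : Equiv.Perm (ℂ × ℂ)} (hg : g ∈ Gam e₁ e₁' e₂ e₂') :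
    ∃ p q m n : ℤ, NormalForm e₁ e₁' e₂ e₂' p q m n g := by
  induction hg using Subgroup.closure_induction with
  | mem x hx =>
    rcases hx with rfl | rfl | rfl | rfl | rfl | rfl
    exacts [⟨_, _, _, _, gamma1⟩, ⟨_, _, _, _, gamma2⟩, ⟨_, _, _, _, tr_fst⟩,
      ⟨_, _, _, _, tr_fst'⟩, ⟨_, _, _, _, tr_snd⟩, ⟨_, _, _, _, tr_snd'⟩]
  | one => exact ⟨0, 0, 0, 0, fun z => by simp⟩
  | mul x y _ _ hx hy =>
    obtain ⟨_, _, _, _, hx⟩ := hx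
    obtain ⟨_, _, _, _, hy⟩ := hy
    exact ⟨_, _, _, _, hx.mul hy⟩
  | inv x _ hx =>
    obtain ⟨_, _, _, _, hx⟩ := hx
    exact ⟨_, _, _, _, hx.inv⟩

lemma eq_of_half_add_eq {e e' : ℂ} (h : LinearIndependent ℝ ![e, e']) {p m p' m' : ℤ}
    (heq : (p : ℂ) / 2 * e + m * e' = p' / 2 * e + m' * e') : p = p' ∧ m = m' := by
  have := LinearIndependent.pair_iff.1 h (((p : ℝ) - p') / 2) (m - m') (by
    simp only [Complex.real_smul]
    push_cast
    linear_combination heq)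
  constructor
  · exact_mod_cast (by linarith [this.1] : (p : ℝ) = p')
  · exact_mod_cast (by linarith [this.2] : (m : ℝ) = m')

lemma unique (h₁ : LinearIndependent ℝ ![e₁, e₁']) (h₂ : LinearIndependent ℝ ![e₂, e₂'])
    {p q m n p' q' m' n' : ℤ} {g : Equiv.Perm (ℂ × ℂ)}
    (h : NormalForm e₁ e₁' e₂ e₂' p q m n g) (h' : NormalForm e₁ e₁' e₂ e₂' p' q' m' n' g) :
    p = p' ∧ q = q' ∧ m = m' ∧ n = n' := by
  have h0 := (h 0).symm.trans (h' 0)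
  simp only [Prod.fst_zero, Prod.snd_zero, mul_zero, zero_add, Prod.mk.injEq] at h0
  obtain ⟨hp, hm⟩ := eq_of_half_add_eq h₁ h0.1
  obtain ⟨hq, hn⟩ := eq_of_half_add_eq h₂ h0.2
  exact ⟨hp, hq, hm, hn⟩

end NormalForm

lemma exists_hom_abelianValue {e₁ e₁' e₂ e₂' : ℂ} (h₁ : LinearIndependent ℝ ![e₁, e₁'])
    (h₂ : LinearIndependent ℝ ![e₂, e₂']) :
    ∃ f : ↥(Gam e₁ e₁' e₂ e₂') →* Multiplicative (ZMod 4 × ZMod 2 × ZMod 2 × ZMod 2),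
      ∀ (g : ↥(Gam e₁ e₁' e₂ e₂')) (p q m n : ℤ),
        NormalForm e₁ e₁' e₂ e₂' p q m n g → f g = abelianValue p q m n := by
  choose p q m n hN using
    fun g : ↥(Gam e₁ e₁' e₂ e₂') => NormalForm.exists_of_mem g.2
  have key : ∀ (g : ↥(Gam e₁ e₁' e₂ e₂')) (a b c d : ℤ), NormalForm e₁ e₁' e₂ e₂' a b c d g →
      abelianValue (p g) (q g) (m g) (n g) = abelianValue a b c d := by
    intro g a b c d h
    obtain ⟨ha, hb, hc, hd⟩ := (hN g).unique h₁ h₂ h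
    rw [ha, hb, hc, hd]
  refine ⟨MonoidHom.mk' (fun g => abelianValue (p g) (q g) (m g) (n g)) fun g g' => ?_, key⟩
  rw [← abelianValue_mul]
  exact key _ _ _ _ _ ((hN g).mul (hN g'))

lemma tr_conj_gamma1 (e₁ v : ℂ) : tr (0, v) * gamma1 e₁ * tr (0, v) = gamma1 e₁ :=
  Equiv.ext fun z => by
    ext <;> simp [tr_apply, gamma1]

lemma tr_conj_gamma2 (e₂ v : ℂ) : tr (v, 0) * gamma2 e₂ * tr (v, 0) = gamma2 e₂ :=
  Equiv.ext fun z => by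
    ext <;> simp [tr_apply, gamma2]

lemma gamma1_mul_self (e₁ : ℂ) : gamma1 e₁ * gamma1 e₁ = tr (e₁, 0) :=
  Equiv.ext fun z => by
    ext <;> simp [tr_apply, gamma1, add_assoc]

lemma gamma2_mul_self (e₂ : ℂ) : gamma2 e₂ * gamma2 e₂ = tr (0, e₂) :=
  Equiv.ext fun z => by
    ext <;> simp [tr_apply, gamma2, add_assoc]

lemma tr_mul_gamma1_mul_gamma2 (e₁ e₂ : ℂ) :
    tr (0, e₂) * (gamma1 e₁ * gamma2 e₂) = tr (e₁, 0) * (gamma2 e₂ * gamma1 e₁) :=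
  Equiv.ext fun z => by
    ext <;> simp [tr_apply, gamma1, gamma2] <;> ring

/-- In a commutative quotient of `Gam`, every element is a word in the images of `γ₁`, `γ₁⁻¹γ₂`
and the two translations by `e₁'` and `e₂'`, and these have order dividing `4, 2, 2, 2`. -/
lemma Gam.exists_zpow_word {e₁ e₁' e₂ e₂' : ℂ} {C : Type*} [CommGroup C]
    (c : ↥(Gam e₁ e₁' e₂ e₂') →* C) {x y u v : C}
    (hx : c ⟨gamma1 e₁, Subgroup.subset_closure (by simp)⟩ = x)
    (hy : c ⟨gamma2 e₂, Subgroup.subset_closure (by simp)⟩ = y)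
    (hu : c ⟨tr (e₁', 0), Subgroup.subset_closure (by simp)⟩ = u)
    (hv : c ⟨tr (0, e₂'), Subgroup.subset_closure (by simp)⟩ = v) :
    (x ^ (4 : ℤ) = 1 ∧ (x⁻¹ * y) ^ (2 : ℤ) = 1 ∧ u ^ (2 : ℤ) = 1 ∧ v ^ (2 : ℤ) = 1) ∧
      ∀ g, ∃ i j k l : ℤ, c g = x ^ i * (x⁻¹ * y) ^ j * u ^ k * v ^ l := by
  obtain ⟨s, hs⟩ : ∃ s, c ⟨tr (e₁, 0), Subgroup.subset_closure (by simp)⟩ = s := ⟨_, rfl⟩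
  obtain ⟨t, ht⟩ : ∃ t, c ⟨tr (0, e₂), Subgroup.subset_closure (by simp)⟩ = t := ⟨_, rfl⟩
  have hxs : x * x = s := by
    rw [← hx, ← hs, ← map_mul]
    exact congrArg c (Subtype.ext (gamma1_mul_self e₁))
  have hyt : y * y = t := by
    rw [← hy, ← ht, ← map_mul]
    exact congrArg c (Subtype.ext (gamma2_mul_self e₂))
  have hst : t * (x * y) = s * (y * x) := by
    rw [← hx, ← hy, ← hs, ← ht]
    simp only [← map_mul]
    exact congrArg c (Subtype.ext (tr_mul_gamma1_mul_gamma2 e₁ e₂))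
  have hsy : s * y * s = y := by
    rw [← hy, ← hs]
    simp only [← map_mul]
    exact congrArg c (Subtype.ext (tr_conj_gamma2 e₂ e₁))
  have huy : u * y * u = y := by
    rw [← hy, ← hu]
    simp only [← map_mul]
    exact congrArg c (Subtype.ext (tr_conj_gamma2 e₂ e₁'))
  have hvx : v * x * v = x := by
    rw [← hx, ← hv]
    simp only [← map_mul]
    exact congrArg c (Subtype.ext (tr_conj_gamma1 e₁ e₂'))
  have square_eq_one {a b : C} (h : a * b * a = b) : a * a = 1 := by
    rwa [mul_right_comm, mul_eq_right] at h
  have hts : t = s := by rwa [mul_comm y x, mul_left_inj] at hst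
  refine ⟨⟨?_, ?_, ?_, ?_⟩, ?_⟩
  · rw [show (4 : ℤ) = 2 + 2 from rfl, zpow_add, zpow_two, hxs, square_eq_one hsy]
  · rw [mul_zpow, inv_zpow, zpow_two, zpow_two, hxs, hyt, hts, inv_mul_cancel]
  · rw [zpow_two, square_eq_one huy]
  · rw [zpow_two, square_eq_one hvx]
  rintro ⟨g, hg⟩
  induction hg using Subgroup.closure_induction with
  | mem z hz =>
    rcases hz with rfl | rfl | rfl | rfl | rfl | rfl
    · exact ⟨1, 0, 0, 0, by simpa using hx⟩
    · exact ⟨1, 1, 0, 0, by simpa using hy⟩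
    · exact ⟨2, 0, 0, 0, by simpa only [zpow_two, hxs, zpow_zero, mul_one] using hs⟩
    · exact ⟨0, 0, 1, 0, by simpa using hu⟩
    · exact ⟨2, 0, 0, 0, by simpa only [zpow_two, hxs, ← hts, zpow_zero, mul_one] using ht⟩
    · exact ⟨0, 0, 0, 1, by simpa using hv⟩
  | one => exact ⟨0, 0, 0, 0, (map_one c).trans (by simp)⟩
  | mul a b ha hb iha ihb =>
    obtain ⟨i, j, k, l, h⟩ := iha
    obtain ⟨i', j', k', l', h'⟩ := ihb
    refine ⟨i + i', j + j', k + k', l + l', ?_⟩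
    have hab := map_mul c ⟨a, ha⟩ ⟨b, hb⟩
    rw [h, h'] at hab
    refine hab.trans ?_
    simp only [zpow_add]
    simp only [mul_assoc, mul_left_comm, mul_comm]
  | inv a ha iha =>
    obtain ⟨i, j, k, l, h⟩ := iha
    refine ⟨-i, -j, -k, -l, ?_⟩
    have hinv := map_inv c ⟨a, ha⟩
    rw [h] at hinv
    refine hinv.trans ?_
    simp only [zpow_neg, mul_inv]

lemma zpow_word_ofAdd (i j k l : ℤ) :
    (Multiplicative.ofAdd ((1, 0, 0, 0) : ZMod 4 × ZMod 2 × ZMod 2 × ZMod 2)) ^ i *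
      ((Multiplicative.ofAdd ((1, 0, 0, 0) : ZMod 4 × ZMod 2 × ZMod 2 × ZMod 2))⁻¹ *
        Multiplicative.ofAdd ((1, 1, 0, 0) : ZMod 4 × ZMod 2 × ZMod 2 × ZMod 2)) ^ j *
      (Multiplicative.ofAdd ((0, 0, 1, 0) : ZMod 4 × ZMod 2 × ZMod 2 × ZMod 2)) ^ k *
      (Multiplicative.ofAdd ((0, 0, 0, 1) : ZMod 4 × ZMod 2 × ZMod 2 × ZMod 2)) ^ l =
    Multiplicative.ofAdd ((i : ZMod 4), (j : ZMod 2), (k : ZMod 2), (l : ZMod 2)) := by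
  simp only [← ofAdd_neg, ← ofAdd_add, ← ofAdd_zsmul]
  simp

/-- The abelianization Γ/[Γ,Γ] ≅ ℤ/4ℤ × (ℤ/2ℤ)³, where an isomorphism can be chosen
sending the class of γ₁ to (1,0,0,0), of γ₂ to (1,1,0,0), of t_{(e₁',0)} to (0,0,1,0)
and of t_{(0,e₂')} to (0,0,0,1). -/
theorem stmt_12 (e₁ e₁' e₂ e₂' : ℂ)
    (h₁ : LinearIndependent ℝ ![e₁, e₁'])
    (h₂ : LinearIndependent ℝ ![e₂, e₂']) :
    ∃ φ : Abelianization ↥(Gam e₁ e₁' e₂ e₂') ≃*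
        Multiplicative (ZMod 4 × ZMod 2 × ZMod 2 × ZMod 2),
      φ (Abelianization.of ⟨gamma1 e₁, Subgroup.subset_closure (by simp)⟩) =
        Multiplicative.ofAdd (1, 0, 0, 0) ∧
      φ (Abelianization.of ⟨gamma2 e₂, Subgroup.subset_closure (by simp)⟩) =
        Multiplicative.ofAdd (1, 1, 0, 0) ∧
      φ (Abelianization.of ⟨tr (e₁', 0), Subgroup.subset_closure (by simp)⟩) =
        Multiplicative.ofAdd (0, 0, 1, 0) ∧
      φ (Abelianization.of ⟨tr (0, e₂'), Subgroup.subset_closure (by simp)⟩) =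
        Multiplicative.ofAdd (0, 0, 0, 1) := by
  obtain ⟨f, hf⟩ := exists_hom_abelianValue h₁ h₂
  have hx := (hf ⟨gamma1 e₁, Subgroup.subset_closure (by simp)⟩ _ _ _ _ NormalForm.gamma1).trans
    (show _ = Multiplicative.ofAdd (1, 0, 0, 0) by simp [abelianValue])
  have hy := (hf ⟨gamma2 e₂, Subgroup.subset_closure (by simp)⟩ _ _ _ _ NormalForm.gamma2).trans
    (show _ = Multiplicative.ofAdd (1, 1, 0, 0) by simp [abelianValue])
  have hu := (hf ⟨tr (e₁', 0), Subgroup.subset_closure (by simp)⟩ _ _ _ _ NormalForm.tr_fst').trans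
    (show _ = Multiplicative.ofAdd (0, 0, 1, 0) by simp [abelianValue])
  have hv := (hf ⟨tr (0, e₂'), Subgroup.subset_closure (by simp)⟩ _ _ _ _ NormalForm.tr_snd').trans
    (show _ = Multiplicative.ofAdd (0, 0, 0, 1) by simp [abelianValue])
  obtain ⟨⟨hx4, hw2, hu2, hv2⟩, hword⟩ :=
    Gam.exists_zpow_word (Abelianization.of (G := ↥(Gam e₁ e₁' e₂ e₂'))) rfl rfl rfl rfl
  have hF (i j k l : ℤ) := zpow_word_ofAdd i j k l
  simp only [← hx, ← hy, ← hu, ← hv, ← Abelianization.lift_apply_of f] at hF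
  simp only [← map_zpow, ← map_mul, ← map_inv] at hF hx4 hw2 hu2 hv2 hword
  have hbij : Function.Bijective (Abelianization.lift f) := by
    constructor
    · rw [injective_iff_map_eq_one]
      intro a ha
      induction a using QuotientGroup.induction_on with
      | H g =>
        change Abelianization.lift f (Abelianization.of g) = 1 at ha
        change Abelianization.of g = 1
        obtain ⟨i, j, k, l, h⟩ := hword g
        rw [h, hF, ← ofAdd_zero, Multiplicative.ofAdd.injective.eq_iff] at ha
        simp only [Prod.mk_eq_zero, ZMod.intCast_zmod_eq_zero_iff_dvd] at ha
        obtain ⟨⟨i, rfl⟩, ⟨j, rfl⟩, ⟨k, rfl⟩, ⟨l, rfl⟩⟩ := ha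
        rw [h]
        simp only [Nat.cast_ofNat, zpow_mul, map_mul, map_zpow] at hx4 hw2 hu2 hv2 ⊢
        simp only [hx4, hw2, hu2, hv2, one_zpow, mul_one]
    · intro b
      obtain ⟨⟨a, b, c, d⟩, rfl⟩ := Multiplicative.ofAdd.surjective b
      obtain ⟨i, rfl⟩ := ZMod.intCast_surjective a
      obtain ⟨j, rfl⟩ := ZMod.intCast_surjective b
      obtain ⟨k, rfl⟩ := ZMod.intCast_surjective c
      obtain ⟨l, rfl⟩ := ZMod.intCast_surjective d
      exact ⟨_, hF i j k l⟩
  exact ⟨MulEquiv.ofBijective _ hbij, hx, hy, hu, hv⟩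
end
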